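/- (MESP stationarity of the all-ones scaling.) Suppose x* maximizes f_DDFact(·;e) over {x ∈ R^n : e^⊤x = s, 0 ≤ x ≤ e} (the unconstrained MESP case, no side constraints Ax ≤ b). Let F_DDFact(x*;e) = Q Diag(λ) Q^⊤ be a spectral decomposition with Q orthonormal and λ decreasingly ordered, and let β ∈ R^k be given by β_i = 1/λ_i for i ≤ ι and β_i = (s−ι)/Σ_{ℓ=ι+1}^k λ_ℓ for i > ι, ι the unique integer of Lemma 1 for λ. Then x* ∘ diag(F Q Diag(β) Q^⊤ F^⊤) = x*; equivalently, the gradient of Υ ↦ f_DDFact(x*;Υ) vanishes at Υ = e, i.e., for every index i with x*_i > 0, (F Q Diag(β) Q^⊤ F^⊤)_{ii} = 1. (Theorem 3.iv, second part) -/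

import Mathlib

open Matrix
open scoped Matrix BigOperators Classical

noncomputable section

/-- `(1/(s−ι)) Σ_{ℓ=ι+1}^k λ_ℓ` (eigenvalues indexed from `1`). -/
def avgTail (k s : ℕ) (lam : ℕ → ℝ) (ι : ℕ) : ℝ :=
  (∑ ℓ ∈ Finset.Icc (ι + 1) k, lam ℓ) / ((s : ℝ) - ι)

/-- The defining property of the unique index `ι` of Lemma 1
(with the convention `λ_0 = +∞`, so for `ι = 0` the left inequality is vacuous). -/
def IsIota (k s : ℕ) (lam : ℕ → ℝ) (ι : ℕ) : Prop :=
  ι < s ∧ (1 ≤ ι → avgTail k s lam ι < lam ι) ∧ lam (ι + 1) ≤ avgTail k s lam ι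

/-- The unique index `ι` of Lemma 1 (junk value `0` if no such index exists). -/
def iotaOf (k s : ℕ) (lam : ℕ → ℝ) : ℕ :=
  if h : ∃ ι, IsIota k s lam ι then h.choose else 0

/-- `φ_s(λ) = Σ_{ℓ=1}^ι log λ_ℓ + (s−ι) log((1/(s−ι)) Σ_{ℓ=ι+1}^k λ_ℓ)`. -/
def phiS (k s : ℕ) (lam : ℕ → ℝ) : ℝ :=
  (∑ ℓ ∈ Finset.Icc 1 (iotaOf k s lam), Real.log (lam ℓ)) +
    ((s : ℝ) - iotaOf k s lam) * Real.log (avgTail k s lam (iotaOf k s lam))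

/-- The decreasingly ordered eigenvalues of a symmetric matrix, indexed from `1`
(junk value `0` outside `[1,k]` or if `X` is not Hermitian). -/
def eigsDesc (k : ℕ) (X : Matrix (Fin k) (Fin k) ℝ) : ℕ → ℝ := fun i =>
  if h : X.IsHermitian then
    ((((List.ofFn h.eigenvalues : List ℝ) : Multiset ℝ).sort (· ≤ ·)).reverse).getD (i - 1) 0
  else 0

/-- `Γ_s(X) = φ_s(λ(X))` with `λ(X)` the decreasingly ordered eigenvalues of `X`. -/
def gammaS (k s : ℕ) (X : Matrix (Fin k) (Fin k) ℝ) : ℝ :=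
  phiS k s (eigsDesc k X)

/-- `F_DDFact(x;Υ) = Fᵀ Diag(Υ∘x) F = Σ_i γ_i x_i F_{i·}ᵀ F_{i·}`. -/
def FDD (n k : ℕ) (F : Matrix (Fin n) (Fin k) ℝ) (x Υ : Fin n → ℝ) :
    Matrix (Fin k) (Fin k) ℝ :=
  Fᵀ * Matrix.diagonal (fun i => Υ i * x i) * F

/-- `f_DDFact(x;Υ) = Γ_s(F_DDFact(x;Υ)) − Σ_i x_i log γ_i`. -/
def fDD (n k s : ℕ) (F : Matrix (Fin n) (Fin k) ℝ) (x Υ : Fin n → ℝ) : ℝ :=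
  gammaS k s (FDD n k F x Υ) - ∑ i, x i * Real.log (Υ i)

/-- `β` of Definition 1: `β_i = 1/λ_i` for `i ≤ ι` and
`β_i = (s−ι)/Σ_{ℓ=ι+1}^k λ_ℓ` for `i > ι` (here `β` is indexed by `Fin k`, `j ↔ j+1`). -/
def betaOf (k s : ℕ) (lam : ℕ → ℝ) : Fin k → ℝ := fun j =>
  if (j : ℕ) + 1 ≤ iotaOf k s lam then (lam ((j : ℕ) + 1))⁻¹
  else ((s : ℝ) - iotaOf k s lam) / ∑ ℓ ∈ Finset.Icc (iotaOf k s lam + 1) k, lam ℓ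

/-- `F Q Diag(β) Qᵀ Fᵀ`, whose diagonal appears in the (generalized) gradients. -/
def gMat (n k s : ℕ) (F : Matrix (Fin n) (Fin k) ℝ) (Q : Matrix (Fin k) (Fin k) ℝ)
    (lam : ℕ → ℝ) : Matrix (Fin n) (Fin n) ℝ :=
  F * Q * Matrix.diagonal (betaOf k s lam) * Qᵀ * Fᵀ

/-- `Q, λ` form a spectral decomposition of `F_DDFact(x;Υ)` as in Definition 1:
`Q` orthonormal and `F_DDFact(x;Υ) = Q Diag(λ) Qᵀ` with `λ` decreasing and nonnegative
(indexed from `1`). -/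
def IsSpectralDecomp (n k : ℕ) (F : Matrix (Fin n) (Fin k) ℝ) (x Υ : Fin n → ℝ)
    (Q : Matrix (Fin k) (Fin k) ℝ) (lam : ℕ → ℝ) : Prop :=
  Q * Qᵀ = 1 ∧
  FDD n k F x Υ = Q * Matrix.diagonal (fun j : Fin k => lam ((j : ℕ) + 1)) * Qᵀ ∧
  (∀ i, 0 ≤ lam i) ∧
  (∀ i j, 1 ≤ i → i ≤ j → j ≤ k → lam j ≤ lam i)

/-- Euclidean (2-)norm of a vector in `ℝⁿ`. -/
def enorm2 (n : ℕ) (v : Fin n → ℝ) : ℝ :=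
  Real.sqrt (∑ i, (v i) ^ 2)

/-- The concave `C¹` function equal to `a` for `a ≤ 1` and to `log a + 1` for `1 ≤ a`. -/
def cappedLog (a : ℝ) : ℝ := if 1 ≤ a then Real.log a + 1 else a

lemma cappedLog_le_tangent {a b : ℝ} (ha : 0 ≤ a) :
    cappedLog a ≤ cappedLog b + (max b 1)⁻¹ * (a - b) := by
  unfold cappedLog
  have hlog : 1 ≤ a → Real.log a ≤ a - 1 := fun h => Real.log_le_sub_one_of_pos (by linarith)
  rcases le_or_gt 1 b with hb | hb
  · have hb0 : 0 < b := by linarith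
    rw [if_pos hb, max_eq_left hb]
    have h1 : b⁻¹ * (a - b) = a / b - 1 := by field_simp
    rw [h1]
    split_ifs with h
    · have := Real.log_le_sub_one_of_pos (div_pos (show 0 < a by linarith) hb0)
      rw [Real.log_div (by linarith) hb0.ne'] at this
      linarith
    · have h2 := Real.log_le_sub_one_of_pos (inv_pos.mpr hb0)
      rw [Real.log_inv] at h2
      have h3 : a - a / b ≤ 1 - b⁻¹ := by
        have : a - a / b = a * (1 - b⁻¹) := by field_simp
        rw [this]
        have : b⁻¹ ≤ 1 := inv_le_one_of_one_le₀ hb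
        nlinarith
      linarith
  · rw [if_neg (not_le.mpr hb), max_eq_right hb.le]
    split_ifs with h
    · linarith [hlog h]
    · linarith

lemma cappedLog_div_ge {a r : ℝ} (ha : 0 ≤ a) (hr : 0 < r) :
    cappedLog a - min 1 a * Real.log r ≤ cappedLog (a / r) := by
  unfold cappedLog
  have hlr : -Real.log r ≤ 1 / r - 1 := by
    have := Real.log_le_sub_one_of_pos (inv_pos.mpr hr)
    rwa [Real.log_inv, ← one_div] at this
  rcases le_or_gt 1 a with h | h
  · rw [if_pos h, min_eq_left h]
    have ha0 : 0 < a := by linarith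
    split_ifs with h'
    · rw [Real.log_div ha0.ne' hr.ne']; linarith
    · have := Real.log_le_sub_one_of_pos (div_pos ha0 hr)
      rw [Real.log_div ha0.ne' hr.ne'] at this
      linarith
  · rw [if_neg (not_le.mpr h), min_eq_right h.le]
    split_ifs with h'
    · have hra : r ≤ a := (one_le_div hr).mp h'
      have ha0 : 0 < a := by linarith
      rw [Real.log_div ha0.ne' hr.ne']
      have h1 : Real.log r ≤ Real.log a := Real.log_le_log hr hra
      have h2 : 1 - a⁻¹ ≤ Real.log a := Real.one_sub_inv_le_log_of_pos ha0
      have h3 : a * (1 - a⁻¹) = a - 1 := by field_simp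
      nlinarith
    · have : a / r = a * (1 / r) := by ring
      rw [this]
      nlinarith

/-- `θ` is the level with `∑ min(θ, dⱼ) = s θ` and fewer than `s` entries of `d` above it. -/
structure IsWaterLevel {k : ℕ} (s : ℕ) (d : Fin k → ℝ) (θ : ℝ) : Prop where
  pos : 0 < θ
  card_lt : (Finset.univ.filter fun j => θ < d j).card < s
  sum_min : ∑ j, min θ (d j) = s * θ

/-- The objective whose minimum over `θ` is `φ_s(d)`, attained at the water level. -/
def levelValue {k : ℕ} (s : ℕ) (d : Fin k → ℝ) (θ : ℝ) : ℝ :=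
  ∑ j, cappedLog (d j / θ) + s * Real.log θ - s

lemma min_one_div {a θ : ℝ} (hθ : 0 < θ) : min 1 (a / θ) = min θ a / θ := by
  rw [← div_self hθ.ne', min_div_div_right hθ.le]

lemma IsWaterLevel.levelValue_le {k s : ℕ} {d : Fin k → ℝ} {θ θ' : ℝ} (h : IsWaterLevel s d θ)
    (hd : ∀ j, 0 ≤ d j) (hθ' : 0 < θ') : levelValue s d θ ≤ levelValue s d θ' := by
  have hθ := h.pos
  have hr : 0 < θ' / θ := div_pos hθ' hθ
  have key : ∑ j, (cappedLog (d j / θ) - min 1 (d j / θ) * Real.log (θ' / θ)) ≤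
      ∑ j, cappedLog (d j / θ') := by
    refine Finset.sum_le_sum fun j _ => ?_
    have := cappedLog_div_ge (div_nonneg (hd j) hθ.le) hr
    rwa [div_div, mul_div_cancel₀ _ hθ.ne'] at this
  have hs : ∑ j, min 1 (d j / θ) = s := by
    simp_rw [min_one_div hθ]
    rw [← Finset.sum_div, h.sum_min, mul_div_assoc, div_self hθ.ne', mul_one]
  rw [Finset.sum_sub_distrib, ← Finset.sum_mul, hs, Real.log_div hθ'.ne' hθ.ne'] at key
  unfold levelValue
  linarith

lemma IsWaterLevel.le_of_isWaterLevel {k s : ℕ} {d : Fin k → ℝ} {θ θ' : ℝ}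
    (h : IsWaterLevel s d θ) (h' : IsWaterLevel s d θ') (hd : ∀ j, 0 ≤ d j) : θ' ≤ θ := by
  by_contra! hlt
  have hθ := h.pos
  have hterm : ∀ j ∈ Finset.univ, θ * min θ' (d j) ≤ θ' * min θ (d j) := fun j _ => by
    rcases le_total θ (d j) with h1 | h1
    · rw [min_eq_left h1]
      nlinarith [min_le_left θ' (d j)]
    · rw [min_eq_right h1, min_eq_right (h1.trans hlt.le)]
      nlinarith [hd j]
  have heq : ∑ j, θ * min θ' (d j) = ∑ j, θ' * min θ (d j) := by
    rw [← Finset.mul_sum, ← Finset.mul_sum, h.sum_min, h'.sum_min]; ring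
  have hall := (Finset.sum_eq_sum_iff_of_le hterm).mp heq
  have hmin : ∀ j, min θ (d j) = if θ < d j then θ else 0 := fun j => by
    have := hall j (Finset.mem_univ j)
    split_ifs with hj
    · exact min_eq_left hj.le
    · push Not at hj
      rw [min_eq_right hj, min_eq_right (hj.trans hlt.le)] at this
      rw [min_eq_right hj]
      nlinarith [hd j]
  have hsum := h.sum_min
  simp_rw [hmin] at hsum
  rw [← Finset.sum_filter, Finset.sum_const, nsmul_eq_mul] at hsum
  have := mul_right_cancel₀ hθ.ne' hsum
  have hc := h.card_lt
  norm_cast at this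
  omega

/-- `Q` is orthogonal and diagonalizes `X` with eigenvalues `d`. -/
structure Diagonalizes {k : ℕ} (Q : Matrix (Fin k) (Fin k) ℝ) (d : Fin k → ℝ)
    (X : Matrix (Fin k) (Fin k) ℝ) : Prop where
  orthogonal : Q * Qᵀ = 1
  eq : X = Q * diagonal d * Qᵀ

namespace Diagonalizes

variable {k : ℕ} {Q P X Y : Matrix (Fin k) (Fin k) ℝ} {d μ : Fin k → ℝ}

lemma orthogonal' (h : Diagonalizes Q d X) : Qᵀ * Q = 1 := mul_eq_one_comm.mp h.orthogonal

lemma conj_cancel (h : Diagonalizes Q d X) (A : Matrix (Fin k) (Fin k) ℝ) :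
    Qᵀ * (Q * A) = A := by rw [← Matrix.mul_assoc, h.orthogonal', Matrix.one_mul]

/-- Functions of a diagonalized matrix do not depend on the diagonalization. -/
lemma conj_comp_congr (hQ : Diagonalizes Q d X) (hP : Diagonalizes P μ X) (g : ℝ → ℝ) :
    Q * diagonal (fun j => g (d j)) * Qᵀ = P * diagonal (fun j => g (μ j)) * Pᵀ := by
  have hR : Pᵀ * Q * diagonal d = diagonal μ * (Pᵀ * Q) := by
    have h : Q * diagonal d * Qᵀ = P * diagonal μ * Pᵀ := hQ.eq.symm.trans hP.eq
    have h1 : Pᵀ * (Q * diagonal d * Qᵀ) * Q = Pᵀ * (P * diagonal μ * Pᵀ) * Q := by rw [h]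
    simpa only [Matrix.mul_assoc, hQ.orthogonal', hP.conj_cancel, Matrix.mul_one] using h1
  have hRg : Pᵀ * Q * diagonal (fun j => g (d j)) = diagonal (fun j => g (μ j)) * (Pᵀ * Q) := by
    ext i j
    have := congrFun (congrFun hR i) j
    rw [mul_diagonal, diagonal_mul] at this ⊢
    rcases eq_or_ne ((Pᵀ * Q) i j) 0 with h0 | h0
    · simp [h0]
    · have : d j = μ i := mul_left_cancel₀ h0 (this.trans (mul_comm _ _))
      rw [this, mul_comm]
  have h2 : P * (Pᵀ * Q * diagonal (fun j => g (d j))) * Qᵀ =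
      P * (diagonal (fun j => g (μ j)) * (Pᵀ * Q)) * Qᵀ := by rw [hRg]
  calc _ = P * (Pᵀ * Q * diagonal (fun j => g (d j))) * Qᵀ := by
        simp only [← Matrix.mul_assoc, hP.orthogonal, Matrix.one_mul]
    _ = _ := by rw [h2]; simp only [Matrix.mul_assoc, hQ.orthogonal, Matrix.mul_one]

lemma trace_conj (h : Diagonalizes Q d X) (w : Fin k → ℝ) :
    trace (Q * diagonal w * Qᵀ) = ∑ j, w j := by
  rw [Matrix.mul_assoc, trace_mul_comm, Matrix.mul_assoc, h.orthogonal', Matrix.mul_one,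
    trace_diagonal]

lemma sum_comp_congr (hQ : Diagonalizes Q d X) (hP : Diagonalizes P μ X) (g : ℝ → ℝ) :
    ∑ j, g (d j) = ∑ j, g (μ j) := by
  rw [← hQ.trace_conj, ← hP.trace_conj, hQ.conj_comp_congr hP]

lemma trace_conj_mul_self (h : Diagonalizes Q d X) (w : Fin k → ℝ) :
    trace (Q * diagonal w * Qᵀ * X) = ∑ j, w j * d j := by
  have : Q * diagonal w * Qᵀ * X = Q * diagonal (fun j => w j * d j) * Qᵀ := by
    rw [h.eq, ← diagonal_mul_diagonal]
    simp only [Matrix.mul_assoc, h.conj_cancel]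
  rw [this, h.trace_conj]

/-- Klein's inequality. -/
lemma sum_le_sum_add_trace (hP : Diagonalizes P μ X) (hQ : Diagonalizes Q d Y) (u v : ℝ → ℝ)
    (huv : ∀ i j, u (μ i) ≤ u (d j) + v (d j) * (μ i - d j)) :
    ∑ i, u (μ i) ≤ ∑ j, u (d j) + trace (Q * diagonal (fun j => v (d j)) * Qᵀ * (X - Y)) := by
  rw [Matrix.mul_sub, trace_sub, hQ.trace_conj_mul_self]
  set R := Pᵀ * Q with hRdef
  have hRt : Rᵀ = Qᵀ * P := by rw [hRdef, transpose_mul, transpose_transpose]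
  have hrow : ∀ i, ∑ j, R i j * R i j = 1 := fun i => by
    have h : R * Rᵀ = 1 := by
      rw [hRt, hRdef, Matrix.mul_assoc, ← Matrix.mul_assoc Q, hQ.orthogonal, Matrix.one_mul,
        hP.orthogonal']
    simpa [Matrix.mul_apply] using congrFun (congrFun h i) i
  have hcol : ∀ j, ∑ i, R i j * R i j = 1 := fun j => by
    have h : Rᵀ * R = 1 := by
      rw [hRt, hRdef, Matrix.mul_assoc, ← Matrix.mul_assoc P, hP.orthogonal, Matrix.one_mul,
        hQ.orthogonal']
    simpa [Matrix.mul_apply] using congrFun (congrFun h j) j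
  have htr : trace (Q * diagonal (fun j => v (d j)) * Qᵀ * X) =
      ∑ i, ∑ j, R i j * R i j * (v (d j) * μ i) := by
    have : trace (Q * diagonal (fun j => v (d j)) * Qᵀ * X) =
        trace (R * diagonal (fun j => v (d j)) * (Rᵀ * diagonal μ)) := by
      rw [hP.eq, hRt, hRdef]
      conv_rhs => rw [Matrix.mul_assoc Pᵀ, Matrix.mul_assoc Pᵀ, trace_mul_comm]
      simp only [Matrix.mul_assoc]
    rw [this]
    simp only [trace, diag_apply, Matrix.mul_apply (M := R * _), mul_diagonal, transpose_apply]
    exact Finset.sum_congr rfl fun i _ => Finset.sum_congr rfl fun j _ => by ring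
  rw [htr]
  have h1 : ∑ i, u (μ i) = ∑ i, ∑ j, R i j * R i j * u (μ i) :=
    Finset.sum_congr rfl fun i _ => by rw [← Finset.sum_mul, hrow, one_mul]
  have h2 : ∀ f : Fin k → ℝ, ∑ j, f j = ∑ i, ∑ j, R i j * R i j * f j := fun f => by
    rw [Finset.sum_comm]
    exact Finset.sum_congr rfl fun j _ => by rw [← Finset.sum_mul, hcol, one_mul]
  rw [h1, h2 fun j => u (d j), h2 fun j => v (d j) * d j, ← Finset.sum_sub_distrib,
    ← Finset.sum_add_distrib]
  refine Finset.sum_le_sum fun i _ => ?_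
  rw [← Finset.sum_sub_distrib, ← Finset.sum_add_distrib]
  refine Finset.sum_le_sum fun j _ => ?_
  nlinarith [mul_le_mul_of_nonneg_left (huv i j) (mul_self_nonneg (R i j))]

/-- The inverse of `max(X, θ)` is a supergradient of `levelValue`. -/
lemma levelValue_le_add_trace {s : ℕ} {θ θ' : ℝ} (hP : Diagonalizes P μ X)
    (hQ : Diagonalizes Q d Y) (hμ : ∀ i, 0 ≤ μ i) (hθ : 0 < θ) (hwl : IsWaterLevel s μ θ') :
    levelValue s μ θ' ≤ levelValue s d θ +
      trace (Q * diagonal (fun j => (max (d j) θ)⁻¹) * Qᵀ * (X - Y)) := by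
  refine (hwl.levelValue_le hμ hθ).trans ?_
  have := hP.sum_le_sum_add_trace hQ (fun a => cappedLog (a / θ)) (fun b => (max b θ)⁻¹)
    fun i j => by
      have := cappedLog_le_tangent (b := d j / θ) (div_nonneg (hμ i) hθ.le)
      convert this using 2
      rw [← div_self hθ.ne', max_div_div_right hθ.le]
      field_simp
  unfold levelValue
  linarith

lemma rank_eq (h : Diagonalizes Q d X) : X.rank = (Finset.univ.filter fun j => d j ≠ 0).card := by
  have hu : IsUnit Q.det := (isUnit_iff_isUnit_det _).mp (.of_mul_eq_one _ h.orthogonal)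
  rw [h.eq, rank_mul_eq_left_of_isUnit_det _ _ (by rwa [det_transpose]),
    rank_mul_eq_right_of_isUnit_det _ _ hu, rank_diagonal, Fintype.card_subtype]

end Diagonalizes

lemma IsWaterLevel.congr {k s : ℕ} {Q P X : Matrix (Fin k) (Fin k) ℝ} {d μ : Fin k → ℝ} {θ : ℝ}
    (hQ : Diagonalizes Q d X) (hP : Diagonalizes P μ X) (h : IsWaterLevel s μ θ) :
    IsWaterLevel s d θ := by
  refine ⟨h.pos, ?_, ?_⟩
  · have h1 := hQ.sum_comp_congr hP fun a => if θ < a then 1 else 0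
    simp only [Finset.sum_boole, Nat.cast_inj] at h1
    rw [h1]; exact h.card_lt
  · rw [hQ.sum_comp_congr hP fun a => min θ a]; exact h.sum_min

lemma sum_fin_succ_eq_sum_Icc {k ι : ℕ} (hι : ι ≤ k) (g : ℕ → ℝ) :
    ∑ j : Fin k, g (j + 1) =
      ∑ ℓ ∈ Finset.Icc 1 ι, g ℓ + ∑ ℓ ∈ Finset.Icc (ι + 1) k, g ℓ := by
  have hIcc : ∀ a b : ℕ, Finset.Icc (a + 1) b = Finset.Ico (a + 1) (b + 1) := fun a b => by
    ext; simp only [Finset.mem_Icc, Finset.mem_Ico]; omega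
  rw [Fin.sum_univ_eq_sum_range (fun i => g (i + 1)), Finset.range_eq_Ico,
    Finset.sum_Ico_add' g 0 k 1, hIcc ι k, ← zero_add 1, hIcc 0 ι,
    Finset.sum_Ico_consecutive _ (by omega) (by omega)]

lemma exists_isIota {k s : ℕ} {lam : ℕ → ℝ} (hs0 : 0 < s) (hsk : s ≤ k)
    (hnn : ∀ i, 1 ≤ i → i ≤ k → 0 ≤ lam i) : ∃ ι, IsIota k s lam ι := by
  have hlast : lam (s - 1 + 1) ≤ avgTail k s lam (s - 1) := by
    have h1 : s - 1 + 1 = s := by omega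
    have h2 : (s : ℝ) - (s - 1 : ℕ) = 1 := by rw [Nat.cast_sub hs0]; simp
    unfold avgTail
    rw [h1, h2, div_one]
    refine Finset.single_le_sum (f := lam) (fun i hi => ?_) (Finset.mem_Icc.mpr ⟨le_rfl, hsk⟩)
    rw [Finset.mem_Icc] at hi
    exact hnn i (by omega) hi.2
  have hex : ∃ ι, lam (ι + 1) ≤ avgTail k s lam ι := ⟨s - 1, hlast⟩
  have hlt : Nat.find hex < s := by
    have := Nat.find_min' hex hlast
    omega
  refine ⟨Nat.find hex, hlt, fun h1 => ?_, Nat.find_spec hex⟩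
  obtain ⟨m, hm⟩ : ∃ m, Nat.find hex = m + 1 := ⟨Nat.find hex - 1, by omega⟩
  have hmin := Nat.find_min hex (m := m) (by omega)
  rw [hm] at hlt ⊢
  have hms : ((m + 1 : ℕ) : ℝ) < s := by exact_mod_cast hlt
  push_cast at hms
  unfold avgTail at hmin ⊢
  rw [Finset.Icc_eq_cons_Ioc (by omega), Finset.sum_cons, not_le, div_lt_iff₀ (by linarith)] at hmin
  have hI : Finset.Ioc (m + 1) k = Finset.Icc (m + 1 + 1) k := by
    ext; simp only [Finset.mem_Icc, Finset.mem_Ioc]; omega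
  rw [hI] at hmin
  rw [div_lt_iff₀ (by push_cast; linarith)]
  push_cast
  linarith

lemma isIota_iotaOf {k s : ℕ} {lam : ℕ → ℝ} (hs0 : 0 < s) (hsk : s ≤ k)
    (hnn : ∀ i, 1 ≤ i → i ≤ k → 0 ≤ lam i) : IsIota k s lam (iotaOf k s lam) := by
  have h := exists_isIota hs0 hsk hnn
  rw [iotaOf, dif_pos h]
  exact h.choose_spec

namespace IsIota

variable {k s ι : ℕ} {lam : ℕ → ℝ}

lemma avgTail_lt (h : IsIota k s lam ι) (hsk : s ≤ k)
    (hanti : ∀ i j, 1 ≤ i → i ≤ j → j ≤ k → lam j ≤ lam i) {i : ℕ} (h1 : 1 ≤ i) (hi : i ≤ ι) :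
    avgTail k s lam ι < lam i :=
  (h.2.1 (h1.trans hi)).trans_le (hanti i ι h1 hi (h.1.le.trans hsk))

lemma le_avgTail (h : IsIota k s lam ι)
    (hanti : ∀ i j, 1 ≤ i → i ≤ j → j ≤ k → lam j ≤ lam i) {i : ℕ} (hi : ι < i) (hik : i ≤ k) :
    lam i ≤ avgTail k s lam ι :=
  (hanti (ι + 1) i (by omega) hi hik).trans h.2.2

lemma avgTail_pos (h : IsIota k s lam ι) (hsk : s ≤ k)
    (hanti : ∀ i j, 1 ≤ i → i ≤ j → j ≤ k → lam j ≤ lam i) (hpos : 0 < lam s) :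
    0 < avgTail k s lam ι :=
  hpos.trans_le (h.le_avgTail hanti h.1 hsk)

lemma sum_tail (h : IsIota k s lam ι) :
    ∑ ℓ ∈ Finset.Icc (ι + 1) k, lam ℓ = (s - ι) * avgTail k s lam ι := by
  have : (ι : ℝ) < s := by exact_mod_cast h.1
  rw [avgTail, mul_div_cancel₀]
  linarith

lemma isWaterLevel (h : IsIota k s lam ι) (hsk : s ≤ k)
    (hanti : ∀ i j, 1 ≤ i → i ≤ j → j ≤ k → lam j ≤ lam i) (hpos : 0 < lam s) :
    IsWaterLevel s (fun j : Fin k => lam (j + 1)) (avgTail k s lam ι) := by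
  refine ⟨h.avgTail_pos hsk hanti hpos, ?_, ?_⟩
  · refine lt_of_le_of_lt ?_ h.1
    rw [← Finset.card_range ι]
    refine Finset.card_le_card_of_injOn (fun j => (j : ℕ)) (fun j hj => ?_)
      (Fin.val_injective.injOn)
    have hj' : avgTail k s lam ι < lam (j + 1) := by simpa using hj
    by_contra hlt
    simp only [Finset.coe_range, Set.mem_Iio, not_lt] at hlt
    exact absurd (h.le_avgTail hanti (i := j + 1) (by omega) j.2) (not_le.mpr hj')
  · rw [sum_fin_succ_eq_sum_Icc (h.1.le.trans hsk) fun i => min (avgTail k s lam ι) (lam i)]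
    have h1 : ∑ ℓ ∈ Finset.Icc 1 ι, min (avgTail k s lam ι) (lam ℓ) =
        ι * avgTail k s lam ι := by
      rw [Finset.sum_congr rfl fun i hi => min_eq_left (h.avgTail_lt hsk hanti
        (Finset.mem_Icc.mp hi).1 (Finset.mem_Icc.mp hi).2).le]
      simp
    have h2 : ∑ ℓ ∈ Finset.Icc (ι + 1) k, min (avgTail k s lam ι) (lam ℓ) =
        (s - ι) * avgTail k s lam ι := by
      rw [Finset.sum_congr rfl fun i hi => min_eq_right (h.le_avgTail hanti
        (Finset.mem_Icc.mp hi).1 (Finset.mem_Icc.mp hi).2), h.sum_tail]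
    rw [h1, h2]; ring

end IsIota

lemma phiS_eq_levelValue {k s : ℕ} {lam : ℕ → ℝ} (hs0 : 0 < s) (hsk : s ≤ k)
    (hnn : ∀ i, 1 ≤ i → i ≤ k → 0 ≤ lam i)
    (hanti : ∀ i j, 1 ≤ i → i ≤ j → j ≤ k → lam j ≤ lam i) (hpos : 0 < lam s) :
    phiS k s lam =
      levelValue s (fun j : Fin k => lam (j + 1)) (avgTail k s lam (iotaOf k s lam)) := by
  have h := isIota_iotaOf hs0 hsk hnn
  unfold phiS levelValue
  have hθ := h.avgTail_pos hsk hanti hpos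
  have htail := h.sum_tail
  set ι := iotaOf k s lam
  set θ := avgTail k s lam ι
  have hcap : ∀ i ∈ Finset.Icc (ι + 1) k, cappedLog (lam i / θ) = lam i / θ := fun i hi => by
    have hle := h.le_avgTail hanti (Finset.mem_Icc.mp hi).1 (Finset.mem_Icc.mp hi).2
    unfold cappedLog
    split_ifs with h1
    · have h2 : lam i / θ = 1 := le_antisymm ((div_le_one hθ).mpr hle) h1
      rw [h2]; simp
    · rfl
  have hlog : ∀ i ∈ Finset.Icc 1 ι, cappedLog (lam i / θ) = Real.log (lam i) + (1 - Real.log θ) :=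
    fun i hi => by
      have hlt := h.avgTail_lt hsk hanti (Finset.mem_Icc.mp hi).1 (Finset.mem_Icc.mp hi).2
      rw [cappedLog, if_pos ((one_le_div hθ).mpr hlt.le),
        Real.log_div (hθ.trans hlt).ne' hθ.ne']
      ring
  rw [sum_fin_succ_eq_sum_Icc (h.1.le.trans hsk) fun i => cappedLog (lam i / θ),
    Finset.sum_congr rfl hcap, Finset.sum_congr rfl hlog, ← Finset.sum_div, htail,
    mul_div_cancel_right₀ _ hθ.ne', Finset.sum_add_distrib]
  simp only [Finset.sum_const, Nat.card_Icc, nsmul_eq_mul, add_tsub_cancel_right]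
  ring

lemma betaOf_eq {k s : ℕ} {lam : ℕ → ℝ} (hs0 : 0 < s) (hsk : s ≤ k)
    (hnn : ∀ i, 1 ≤ i → i ≤ k → 0 ≤ lam i)
    (hanti : ∀ i j, 1 ≤ i → i ≤ j → j ≤ k → lam j ≤ lam i) :
    betaOf k s lam = fun j : Fin k => (max (lam (j + 1)) (avgTail k s lam (iotaOf k s lam)))⁻¹ := by
  have h := isIota_iotaOf hs0 hsk hnn
  funext j
  unfold betaOf
  split_ifs with hj
  · rw [max_eq_left (h.avgTail_lt hsk hanti (by omega) hj).le]
  · rw [max_eq_right (h.le_avgTail hanti (by omega) j.2), avgTail, inv_div]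

lemma Diagonalizes.pos_of_le_rank {k s : ℕ} {Q X : Matrix (Fin k) (Fin k) ℝ} {lam : ℕ → ℝ}
    (h : Diagonalizes Q (fun j => lam (j + 1)) X) (hs0 : 0 < s) (hsX : s ≤ X.rank)
    (hnn : ∀ i, 1 ≤ i → i ≤ k → 0 ≤ lam i)
    (hanti : ∀ i j, 1 ≤ i → i ≤ j → j ≤ k → lam j ≤ lam i) : s ≤ k ∧ 0 < lam s := by
  rw [h.rank_eq] at hsX
  have hsk : s ≤ k := hsX.trans (by simpa using Finset.card_le_univ (α := Fin k) _)
  refine ⟨hsk, ?_⟩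
  by_contra! hle
  suffices (Finset.univ.filter fun j : Fin k => lam (j + 1) ≠ 0).card ≤ s - 1 by omega
  rw [← Finset.card_range (s - 1)]
  refine Finset.card_le_card_of_injOn (fun j => (j : ℕ)) (fun j hj => ?_)
    (Fin.val_injective.injOn)
  have hj' : lam (j + 1) ≠ 0 := by simpa using hj
  by_contra hlt
  simp only [Finset.coe_range, Set.mem_Iio, not_lt] at hlt
  exact hj' (le_antisymm ((hanti s (j + 1) hs0 (by omega) j.2).trans hle)
    (hnn _ (by omega) j.2))

lemma exists_diagonalizes_eigsDesc {k : ℕ} {X : Matrix (Fin k) (Fin k) ℝ} (hX : X.PosSemidef) :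
    (∃ Q, Diagonalizes Q (fun j => eigsDesc k X (j + 1)) X) ∧
      (∀ i, 0 ≤ eigsDesc k X i) ∧
      ∀ i j, 1 ≤ i → i ≤ j → j ≤ k → eigsDesc k X j ≤ eigsDesc k X i := by
  have hH := hX.isHermitian
  let σ := Tuple.sort fun i => -hH.eigenvalues i
  have hσ : Antitone (hH.eigenvalues ∘ σ) := fun i j hij => by
    have := Tuple.monotone_sort (fun i => -hH.eigenvalues i) hij
    simpa [σ] using this
  have hlist : (((List.ofFn hH.eigenvalues : List ℝ) : Multiset ℝ).sort (· ≤ ·)).reverse =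
      List.ofFn (hH.eigenvalues ∘ σ) := by
    refine List.Perm.eq_of_sortedGE ?_ hσ.sortedGE_ofFn ?_
    · exact List.sortedGE_reverse.mpr (Multiset.pairwise_sort _ _).sortedLE
    · refine (List.reverse_perm _).trans (.trans ?_ (Equiv.Perm.ofFn_comp_perm σ _).symm)
      exact Multiset.coe_eq_coe.mp (Multiset.sort_eq _ _)
  have hval : ∀ i, eigsDesc k X i = (List.ofFn (hH.eigenvalues ∘ σ)).getD (i - 1) 0 := fun i => by
    rw [eigsDesc, dif_pos hH, hlist]
  have hfin : ∀ j : Fin k, eigsDesc k X (j + 1) = hH.eigenvalues (σ j) := fun j => by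
    rw [hval, List.getD_eq_getElem _ _ (by simp)]
    simp
  refine ⟨⟨(hH.eigenvectorUnitary : Matrix (Fin k) (Fin k) ℝ).submatrix id σ, ?_, ?_⟩, ?_, ?_⟩
  · rw [transpose_submatrix, submatrix_mul_equiv]
    have := (mem_unitaryGroup_iff.mp hH.eigenvectorUnitary.2)
    rw [star_eq_conjTranspose, conjTranspose_eq_transpose_of_trivial] at this
    rw [this]; simp
  · have hd : diagonal (fun j : Fin k => eigsDesc k X (j + 1)) =
        (diagonal hH.eigenvalues).submatrix σ σ := by
      rw [submatrix_diagonal_equiv]; congr 1; funext j; exact hfin j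
    rw [hd, transpose_submatrix, submatrix_mul_equiv, submatrix_mul_equiv]
    have := hH.spectral_theorem
    rw [Unitary.conjStarAlgAut_apply, star_eq_conjTranspose,
      conjTranspose_eq_transpose_of_trivial] at this
    simpa using this
  · intro i
    rw [hval]
    rcases lt_or_ge (i - 1) k with hi | hi
    · rw [List.getD_eq_getElem _ _ (by simpa using hi)]
      simpa using hX.eigenvalues_nonneg _
    · rw [List.getD_eq_default _ _ (by simpa using hi)]
  · intro i j hi hij hj
    obtain ⟨i, rfl⟩ : ∃ m, i = m + 1 := ⟨i - 1, by omega⟩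
    obtain ⟨j, rfl⟩ : ∃ m, j = m + 1 := ⟨j - 1, by omega⟩
    have h1 := hfin ⟨i, by omega⟩
    have h2 := hfin ⟨j, by omega⟩
    simp only at h1 h2
    rw [h1, h2]
    exact hσ (by simpa using hij)

section FDD

variable {n k : ℕ} {F : Matrix (Fin n) (Fin k) ℝ}

lemma FDD_one_eq (y : Fin n → ℝ) : FDD n k F y 1 = Fᵀ * diagonal y * F := by simp [FDD]

lemma dotProduct_FDD_mulVec (y : Fin n → ℝ) (v : Fin k → ℝ) :
    v ⬝ᵥ FDD n k F y 1 *ᵥ v = ∑ l, y l * (F *ᵥ v) l ^ 2 := by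
  rw [FDD_one_eq, ← mulVec_mulVec, ← mulVec_mulVec, dotProduct_mulVec, vecMul_transpose]
  simp only [dotProduct, mulVec_diagonal]
  exact Finset.sum_congr rfl fun l _ => by ring

lemma FDD_posSemidef {y : Fin n → ℝ} (hy : ∀ l, 0 ≤ y l) : (FDD n k F y 1).PosSemidef := by
  have := (PosSemidef.diagonal hy).conjTranspose_mul_mul_same F
  rwa [conjTranspose_eq_transpose_of_trivial, ← FDD_one_eq] at this

lemma trace_mul_FDD (B : Matrix (Fin k) (Fin k) ℝ) (y : Fin n → ℝ) :
    trace (B * FDD n k F y 1) = ∑ l, y l * (F * B * Fᵀ) l l := by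
  rw [FDD_one_eq, ← Matrix.mul_assoc, trace_mul_comm, ← Matrix.mul_assoc, ← Matrix.mul_assoc]
  simp only [trace, diag_apply, mul_diagonal]
  exact Finset.sum_congr rfl fun l _ => mul_comm _ _

lemma rank_FDD_mono {x y : Fin n → ℝ} (hy : ∀ l, 0 ≤ y l) (hxy : ∀ l, y l = 0 → x l = 0) :
    (FDD n k F x 1).rank ≤ (FDD n k F y 1).rank := by
  have hker : LinearMap.ker (FDD n k F y 1).mulVecLin ≤
      LinearMap.ker (FDD n k F x 1).mulVecLin := by
    intro v hv
    rw [LinearMap.mem_ker, mulVecLin_apply] at hv ⊢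
    have h0 := dotProduct_FDD_mulVec (F := F) y v
    rw [hv, dotProduct_zero, eq_comm,
      Finset.sum_eq_zero_iff_of_nonneg fun l _ => mul_nonneg (hy l) (sq_nonneg _)] at h0
    have h1 : diagonal x *ᵥ (F *ᵥ v) = 0 := by
      funext l
      rw [mulVec_diagonal, Pi.zero_apply]
      rcases mul_eq_zero.mp (h0 l (Finset.mem_univ l)) with h | h
      · rw [hxy l h, zero_mul]
      · rw [pow_eq_zero_iff two_ne_zero |>.mp h, mul_zero]
    rw [FDD_one_eq, ← mulVec_mulVec, ← mulVec_mulVec, h1, mulVec_zero]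
  have h1 := Submodule.finrank_mono hker
  have h2 := (FDD n k F x 1).mulVecLin.finrank_range_add_finrank_ker
  have h3 := (FDD n k F y 1).mulVecLin.finrank_range_add_finrank_ker
  unfold Matrix.rank
  omega

lemma exists_isWaterLevel_FDD {s : ℕ} {y : Fin n → ℝ} (hs0 : 0 < s) (hy : ∀ l, 0 ≤ y l)
    (hrank : s ≤ (FDD n k F y 1).rank) :
    ∃ Q d θ, Diagonalizes Q d (FDD n k F y 1) ∧ (∀ j, 0 ≤ d j) ∧ IsWaterLevel s d θ ∧
      fDD n k s F y 1 = levelValue s d θ := by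
  obtain ⟨⟨Q, hQ⟩, hnn, hanti⟩ := exists_diagonalizes_eigsDesc (FDD_posSemidef (F := F) hy)
  obtain ⟨hsk, hpos⟩ := hQ.pos_of_le_rank hs0 hrank (fun i _ _ => hnn i) hanti
  have hι := isIota_iotaOf hs0 hsk (lam := eigsDesc k (FDD n k F y 1)) fun i _ _ => hnn i
  refine ⟨Q, _, _, hQ, fun j => hnn _, hι.isWaterLevel hsk hanti hpos, ?_⟩
  rw [← phiS_eq_levelValue hs0 hsk (fun i _ _ => hnn i) hanti hpos]
  simp [fDD, gammaS]

/-- The supergradient inequality for `fDD`, the supergradient being taken at `y`. -/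
lemma exists_supergradient_fDD {s : ℕ} {x y : Fin n → ℝ} (hs0 : 0 < s) (hx : ∀ l, 0 ≤ x l)
    (hy : ∀ l, 0 ≤ y l) (hxr : s ≤ (FDD n k F x 1).rank) (hyr : s ≤ (FDD n k F y 1).rank) :
    ∃ Q d θ, Diagonalizes Q d (FDD n k F y 1) ∧ (∀ j, 0 ≤ d j) ∧ IsWaterLevel s d θ ∧
      fDD n k s F x 1 ≤ fDD n k s F y 1 +
        ∑ l, (x l - y l) * (F * (Q * diagonal (fun j => (max (d j) θ)⁻¹) * Qᵀ) * Fᵀ) l l := by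
  obtain ⟨Q, d, θ, hQ, hd, hθ, hfy⟩ := exists_isWaterLevel_FDD hs0 hy hyr
  obtain ⟨P, μ, θ', hP, hμ, hθ', hfx⟩ := exists_isWaterLevel_FDD hs0 hx hxr
  refine ⟨Q, d, θ, hQ, hd, hθ, ?_⟩
  have := hP.levelValue_le_add_trace hQ hμ hθ.pos hθ'
  rw [Matrix.mul_sub, trace_sub, trace_mul_FDD, trace_mul_FDD, ← Finset.sum_sub_distrib] at this
  simp_rw [← sub_mul] at this
  rwa [hfx, hfy]

end FDD

lemma IsWaterLevel.le_sum {k s : ℕ} {d : Fin k → ℝ} {θ : ℝ} (h : IsWaterLevel s d θ)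
    (hs0 : 0 < s) : θ ≤ ∑ j, d j := by
  have h1 : ∑ j, min θ (d j) ≤ ∑ j, d j := Finset.sum_le_sum fun j _ => min_le_right _ _
  rw [h.sum_min] at h1
  have h2 : (1 : ℝ) ≤ s := by exact_mod_cast hs0
  nlinarith [h.pos]

lemma isCompact_setOf_entries_mem_Icc {k : ℕ} {a b : ℝ} :
    IsCompact {A : Matrix (Fin k) (Fin k) ℝ | ∀ i j, A i j ∈ Set.Icc a b} := by
  have h : IsCompact (Set.univ.pi fun _ : Fin k => Set.univ.pi fun _ : Fin k => Set.Icc a b) :=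
    isCompact_univ_pi fun _ => isCompact_univ_pi fun _ => isCompact_Icc
  have hset : {A : Matrix (Fin k) (Fin k) ℝ | ∀ i j, A i j ∈ Set.Icc a b} =
      (Set.univ.pi fun _ : Fin k => Set.univ.pi fun _ : Fin k => Set.Icc a b) :=
    Set.ext fun A =>
      ⟨fun h i _ j _ => h i j, fun h i j => h i (Set.mem_univ i) j (Set.mem_univ j)⟩
  rw [hset]
  exact h

open Filter Topology in
/-- Diagonalizations and water levels converge along a subsequence as long as the rank of the
limit matrix is at least `s`. -/
lemma exists_subseq_tendsto_diagonalizes {k s : ℕ} {X : Matrix (Fin k) (Fin k) ℝ}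
    {Xm Qm : ℕ → Matrix (Fin k) (Fin k) ℝ} {dm : ℕ → Fin k → ℝ} {θm : ℕ → ℝ} (hs0 : 0 < s)
    (hX : Tendsto Xm atTop (𝓝 X)) (hrank : s ≤ X.rank) (hQ : ∀ m, Diagonalizes (Qm m) (dm m) (Xm m))
    (hd : ∀ m j, 0 ≤ dm m j) (hθ : ∀ m, IsWaterLevel s (dm m) (θm m)) :
    ∃ Q d θ, Diagonalizes Q d X ∧ (∀ j, 0 ≤ d j) ∧ IsWaterLevel s d θ ∧ ∃ φ : ℕ → ℕ, StrictMono φ ∧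
      Tendsto (fun m => Qm (φ m) * diagonal (fun j => (max (dm (φ m) j) (θm (φ m)))⁻¹) *
          (Qm (φ m))ᵀ)
        atTop (𝓝 (Q * diagonal (fun j => (max (d j) θ)⁻¹) * Qᵀ)) := by
  have htrace : ∀ m, ∑ j, dm m j = trace (Xm m) := fun m => by
    rw [(hQ m).eq, (hQ m).trace_conj]
  have hcont : Continuous fun A : Matrix (Fin k) (Fin k) ℝ => trace A := by fun_prop
  obtain ⟨L, hL⟩ := ((hcont.tendsto X).comp hX).bddAbove_range
  have hsumL : ∀ m, ∑ j, dm m j ≤ L := fun m => by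
    rw [htrace]; exact hL ⟨m, rfl⟩
  let K : Set (Matrix (Fin k) (Fin k) ℝ × (Fin k → ℝ) × ℝ) :=
    {A | ∀ i j, A i j ∈ Set.Icc (-1 : ℝ) 1} ×ˢ
      (Set.univ.pi fun _ => Set.Icc 0 L) ×ˢ Set.Icc 0 L
  have hK : IsCompact K :=
    isCompact_setOf_entries_mem_Icc.prod
      ((isCompact_univ_pi fun _ => isCompact_Icc).prod isCompact_Icc)
  have hmem : ∀ m, (Qm m, dm m, θm m) ∈ K := fun m => by
    refine ⟨fun i j => ?_, fun j _ => ⟨hd m j, ?_⟩, (hθ m).pos.le,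
      ((hθ m).le_sum hs0).trans (hsumL m)⟩
    · have hU : Qm m ∈ unitaryGroup (Fin k) ℝ := by
        rw [mem_unitaryGroup_iff, star_eq_conjTranspose, conjTranspose_eq_transpose_of_trivial]
        exact (hQ m).orthogonal
      have := entry_norm_bound_of_unitary hU i j
      rwa [Real.norm_eq_abs, abs_le] at this
    · exact (Finset.single_le_sum (fun j _ => hd m j) (Finset.mem_univ j)).trans (hsumL m)
  have : FirstCountableTopology (Matrix (Fin k) (Fin k) ℝ) :=
    inferInstanceAs (FirstCountableTopology (Fin k → Fin k → ℝ))
  obtain ⟨⟨Q, d, θ⟩, -, φ, hφ, hlim⟩ := hK.tendsto_subseq hmem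
  have hQlim : Tendsto (fun m => Qm (φ m)) atTop (𝓝 Q) :=
    (continuous_fst.tendsto _).comp hlim
  have hdlim : Tendsto (fun m => dm (φ m)) atTop (𝓝 d) :=
    ((continuous_fst.comp continuous_snd).tendsto _).comp hlim
  have hθlim : Tendsto (fun m => θm (φ m)) atTop (𝓝 θ) :=
    ((continuous_snd.comp continuous_snd).tendsto _).comp hlim
  have hdj : ∀ j, Tendsto (fun m => dm (φ m) j) atTop (𝓝 (d j)) := tendsto_pi_nhds.mp hdlim
  have hconj : ∀ {w : ℕ → Fin k → ℝ} {w' : Fin k → ℝ}, Tendsto w atTop (𝓝 w') →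
      Tendsto (fun m => Qm (φ m) * diagonal (w m) * (Qm (φ m))ᵀ) atTop
        (𝓝 (Q * diagonal w' * Qᵀ)) := by
    intro w w' hw
    have hw' : Tendsto (fun m => diagonal (w m)) atTop (𝓝 (diagonal w')) :=
      (continuous_id.matrix_diagonal.tendsto w').comp hw
    have hQt : Tendsto (fun m => (Qm (φ m))ᵀ) atTop (𝓝 Qᵀ) :=
      (continuous_id.matrix_transpose.tendsto Q).comp hQlim
    exact (hQlim.mul hw').mul hQt
  have hdiag : Diagonalizes Q d X := by
    refine ⟨tendsto_nhds_unique (f := fun m => Qm (φ m) * (Qm (φ m))ᵀ) (l := atTop) ?_ ?_,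
      tendsto_nhds_unique (hX.comp hφ.tendsto_atTop) ?_⟩
    · have hc : Continuous fun A : Matrix (Fin k) (Fin k) ℝ => A * Aᵀ := by fun_prop
      exact (hc.tendsto Q).comp hQlim
    · simp only [(hQ _).orthogonal]
      exact tendsto_const_nhds
    · refine (hconj hdlim).congr fun m => ?_
      rw [← (hQ (φ m)).eq, Function.comp_apply]
  have hd0 : ∀ j, 0 ≤ d j := fun j => ge_of_tendsto' (hdj j) fun m => hd _ j
  have hθ0 : 0 ≤ θ := ge_of_tendsto' hθlim fun m => (hθ _).pos.le
  have hcard : (Finset.univ.filter fun j => θ < d j).card < s := by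
    have hev : ∀ᶠ m in atTop, ∀ j, θ < d j → θm (φ m) < dm (φ m) j :=
      eventually_all.mpr fun j => by
        by_cases hj : θ < d j
        · filter_upwards [hθlim.eventually_lt (hdj j) hj] with m hm _ using hm
        · exact Eventually.of_forall fun m h => absurd h hj
    obtain ⟨m, hm⟩ := hev.exists
    refine lt_of_le_of_lt (Finset.card_le_card fun j hj => ?_) (hθ (φ m)).card_lt
    simp only [Finset.mem_filter, Finset.mem_univ, true_and] at hj ⊢
    exact hm j hj
  have hθpos : 0 < θ := by
    refine lt_of_le_of_ne hθ0 fun h0 => ?_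
    rw [hdiag.rank_eq] at hrank
    rw [← h0] at hcard
    have : (Finset.univ.filter fun j => d j ≠ 0) = Finset.univ.filter fun j => 0 < d j :=
      Finset.filter_congr fun j _ => ((hd0 j).lt_iff_ne').symm
    rw [this] at hrank
    omega
  refine ⟨Q, d, θ, hdiag, hd0, ⟨hθpos, hcard, ?_⟩, φ, hφ, hconj (tendsto_pi_nhds.mpr fun j => ?_)⟩
  · refine tendsto_nhds_unique (tendsto_finsetSum _ fun j _ => hθlim.min (hdj j)) ?_
    simp only [(hθ _).sum_min]
    exact hθlim.const_mul _
  · exact ((hdj j).max hθlim).inv₀ (lt_max_of_lt_right hθpos).ne'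

lemma Diagonalizes.conj_inv_max_congr {k s : ℕ} {Q P X : Matrix (Fin k) (Fin k) ℝ}
    {d μ : Fin k → ℝ} {θ θ' : ℝ} (hQ : Diagonalizes Q d X) (hP : Diagonalizes P μ X)
    (hd : ∀ j, 0 ≤ d j) (h : IsWaterLevel s d θ) (h' : IsWaterLevel s μ θ') :
    Q * diagonal (fun j => (max (d j) θ)⁻¹) * Qᵀ =
      P * diagonal (fun j => (max (μ j) θ')⁻¹) * Pᵀ := by
  have h'' := h'.congr hQ hP
  obtain rfl := le_antisymm (h''.le_of_isWaterLevel h hd) (h.le_of_isWaterLevel h'' hd)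
  exact hQ.conj_comp_congr hP fun a => (max a θ)⁻¹

open Filter Topology in
/-- First-order optimality: mass cannot profitably be moved from `j` to `i`. -/
lemma grad_le_grad_of_isMax {n k s : ℕ} {F : Matrix (Fin n) (Fin k) ℝ} {x : Fin n → ℝ}
    (hs0 : 0 < s) (hx0 : ∀ i, 0 ≤ x i) (hx1 : ∀ i, x i ≤ 1) (hsum : (∑ i, x i) = (s : ℝ))
    (hxr : s ≤ (FDD n k F x 1).rank)
    (hopt : ∀ y : Fin n → ℝ, (∀ i, 0 ≤ y i) → (∀ i, y i ≤ 1) → (∑ i, y i) = (s : ℝ) →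
      s ≤ (FDD n k F y 1).rank → fDD n k s F y 1 ≤ fDD n k s F x 1)
    {Q : Matrix (Fin k) (Fin k) ℝ} {d : Fin k → ℝ} {θ : ℝ} (hQ : Diagonalizes Q d (FDD n k F x 1))
    (hd : ∀ j, 0 ≤ d j) (hθ : IsWaterLevel s d θ) {i j : Fin n} (hi : x i < 1) (hj : 0 < x j) :
    (F * (Q * diagonal (fun j => (max (d j) θ)⁻¹) * Qᵀ) * Fᵀ) i i ≤
      (F * (Q * diagonal (fun j => (max (d j) θ)⁻¹) * Qᵀ) * Fᵀ) j j := by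
  rcases eq_or_ne i j with rfl | hij
  · exact le_rfl
  let y : ℝ → Fin n → ℝ := fun t => x + t • (Pi.single i 1 - Pi.single j 1)
  have hyi : ∀ t, y t i = x i + t := fun t => by simp [y, hij]
  have hyj : ∀ t, y t j = x j - t := fun t => by simp [y, hij.symm]; ring
  have hyl : ∀ t l, l ≠ i → l ≠ j → y t l = x l := fun t l h1 h2 => by simp [y, h1, h2]
  set ε := min (1 - x i) (x j) / 2 with hε
  have hmin : 0 < min (1 - x i) (x j) := lt_min (by linarith) hj
  have hεi : ε < 1 - x i := by linarith [min_le_left (1 - x i) (x j)]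
  have hεj : ε < x j := by linarith [min_le_right (1 - x i) (x j)]
  have hε0 : 0 < ε := by linarith
  have key : ∀ t, 0 < t → t ≤ ε → ∃ Q d θ, Diagonalizes Q d (FDD n k F (y t) 1) ∧
      (∀ j, 0 ≤ d j) ∧ IsWaterLevel s d θ ∧
      (F * (Q * diagonal (fun j => (max (d j) θ)⁻¹) * Qᵀ) * Fᵀ) i i ≤
        (F * (Q * diagonal (fun j => (max (d j) θ)⁻¹) * Qᵀ) * Fᵀ) j j := by
    intro t ht0 htε
    have hcases : ∀ p : Fin n → Prop, p i → p j → (∀ l, l ≠ i → l ≠ j → p l) → ∀ l, p l :=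
      fun p h1 h2 h3 l => by
        by_cases h : l = i
        · exact h ▸ h1
        · by_cases h' : l = j
          · exact h' ▸ h2
          · exact h3 l h h'
    have hy0 : ∀ l, 0 ≤ y t l := hcases _ (by rw [hyi]; linarith [hx0 i]) (by rw [hyj]; linarith)
      fun l h1 h2 => by rw [hyl t l h1 h2]; exact hx0 l
    have hy1 : ∀ l, y t l ≤ 1 := hcases _ (by rw [hyi]; linarith) (by rw [hyj]; linarith [hx1 j])
      fun l h1 h2 => by rw [hyl t l h1 h2]; exact hx1 l
    have hys : ∑ l, y t l = s := by
      simp [y, Finset.sum_add_distrib, ← Finset.mul_sum, Finset.sum_sub_distrib, hsum]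
    have hyr : s ≤ (FDD n k F (y t) 1).rank :=
      hxr.trans <| rank_FDD_mono hy0 <| hcases _ (by rw [hyi]; intro h; linarith [hx0 i])
        (by rw [hyj]; intro h; linarith) fun l h1 h2 h => by rwa [hyl t l h1 h2] at h
    obtain ⟨Q, d, θ, hQ, hd, hθ, hle⟩ := exists_supergradient_fDD hs0 hx0 hy0 hxr hyr
    refine ⟨Q, d, θ, hQ, hd, hθ, ?_⟩
    have h := hle.trans (add_le_add_left (hopt (y t) hy0 hy1 hys hyr) _)
    set G := F * (Q * diagonal (fun j => (max (d j) θ)⁻¹) * Qᵀ) * Fᵀ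
    have hsumG : ∑ l, (x l - y t l) * G l l = t * (G j j - G i i) := by
      rw [Fintype.sum_eq_add i j hij fun l hl => by rw [hyl t l hl.1 hl.2]; ring, hyi, hyj]
      ring
    rw [hsumG] at h
    have := (mul_nonneg_iff_of_pos_left ht0).mp (show 0 ≤ t * (G j j - G i i) by linarith)
    linarith
  have ht : ∀ m : ℕ, 0 < ε / (m + 1) ∧ ε / (m + 1) ≤ ε := fun m =>
    ⟨by positivity, div_le_self hε0.le (by linarith [m.cast_nonneg (α := ℝ)])⟩
  choose Qm dm θm hQm hdm hθm hgm using fun m : ℕ => key _ (ht m).1 (ht m).2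
  have hlim : Tendsto (fun m : ℕ => FDD n k F (y (ε / (m + 1))) 1) atTop (𝓝 (FDD n k F x 1)) := by
    have hc : Continuous fun t => FDD n k F (y t) 1 := by
      simp only [FDD_one_eq]
      fun_prop
    have h0 : y 0 = x := by simp [y]
    have := (hc.tendsto 0).comp
      ((tendsto_const_div_atTop_nhds_zero_nat ε).comp (tendsto_add_atTop_nat 1))
    rw [h0] at this
    refine this.congr fun m => ?_
    simp
  obtain ⟨Q', d', θ', hQ', hd', hθ', φ, -, hB⟩ :=
    exists_subseq_tendsto_diagonalizes hs0 hlim hxr hQm hdm hθm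
  rw [hQ.conj_inv_max_congr hQ' hd hθ hθ']
  have hG : ∀ l, Continuous fun B : Matrix (Fin k) (Fin k) ℝ => (F * B * Fᵀ) l l := fun l => by
    have : Continuous fun B : Matrix (Fin k) (Fin k) ℝ => F * B * Fᵀ := by fun_prop
    exact this.matrix_elem l l
  exact le_of_tendsto_of_tendsto' (((hG i).tendsto _).comp hB) (((hG j).tendsto _).comp hB)
    fun m => hgm (φ m)

/-- Leverage scores are at most one. -/
lemma mul_grad_le_one {n k : ℕ} {F : Matrix (Fin n) (Fin k) ℝ} {x : Fin n → ℝ}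
    (hx0 : ∀ i, 0 ≤ x i) {Q : Matrix (Fin k) (Fin k) ℝ} {d β : Fin k → ℝ}
    (hQ : Diagonalizes Q d (FDD n k F x 1)) (hβ : ∀ j, 0 ≤ β j) (hβd : ∀ j, β j * d j ≤ 1)
    (i : Fin n) : x i * (F * (Q * diagonal β * Qᵀ) * Fᵀ) i i ≤ 1 := by
  generalize hB : Q * diagonal β * Qᵀ = B
  generalize hg : (F * B * Fᵀ) i i = g
  obtain ⟨a, ha⟩ : ∃ a : Fin k → ℝ, ∀ c, a c = F i c := ⟨_, fun _ => rfl⟩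
  generalize hv : Qᵀ *ᵥ a = v
  have hgi : (F *ᵥ (B *ᵥ a)) i = g := by
    rw [← hg, mulVec_mulVec, Matrix.mul_apply]
    simp only [mulVec, dotProduct, ha, transpose_apply]
  have hBa : Qᵀ *ᵥ (B *ᵥ a) = fun j => β j * v j := by
    rw [← hB, mulVec_mulVec, Matrix.mul_assoc, hQ.conj_cancel, ← mulVec_mulVec, hv]
    funext j
    rw [mulVec_diagonal]
  have hgv : g = ∑ j, β j * v j ^ 2 := by
    have : g = a ⬝ᵥ B *ᵥ a := by
      rw [← hgi]
      simp only [dotProduct, ha, mulVec]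
    rw [this, ← hB, ← mulVec_mulVec, ← mulVec_mulVec, dotProduct_mulVec, ← mulVec_transpose, hv]
    simp only [dotProduct, mulVec_diagonal]
    exact Finset.sum_congr rfl fun j _ => by ring
  have hg0 : 0 ≤ g := hgv ▸ Finset.sum_nonneg fun j _ => mul_nonneg (hβ j) (sq_nonneg _)
  have hquad : (B *ᵥ a) ⬝ᵥ FDD n k F x 1 *ᵥ (B *ᵥ a) ≤ g := by
    rw [hQ.eq, ← mulVec_mulVec, ← mulVec_mulVec, hBa, dotProduct_mulVec, ← mulVec_transpose, hBa,
      hgv]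
    simp only [dotProduct, mulVec_diagonal]
    refine Finset.sum_le_sum fun j _ => ?_
    nlinarith [mul_le_mul_of_nonneg_right (hβd j) (mul_nonneg (hβ j) (sq_nonneg (v j)))]
  rw [dotProduct_FDD_mulVec] at hquad
  have hterm := (Finset.single_le_sum (f := fun l => x l * (F *ᵥ (B *ᵥ a)) l ^ 2)
    (fun l _ => mul_nonneg (hx0 l) (sq_nonneg _)) (Finset.mem_univ i)).trans hquad
  simp only [hgi] at hterm
  by_contra! hlt
  have hgpos : 0 < g := hg0.lt_of_ne fun h => by
    rw [← h, mul_zero] at hlt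
    linarith
  nlinarith

/-- Theorem 3.iv (second part, MESP stationarity of the all-ones scaling): if `x*` maximizes
`f_DDFact(·;e)` over `{x : eᵀx = s, 0 ≤ x ≤ e}` (no side constraints), then for every index
`i` with `x*_i > 0` one has `(F Q Diag(β) Qᵀ Fᵀ)_{ii} = 1`; i.e. the gradient of
`Υ ↦ f_DDFact(x*;Υ)` vanishes at `Υ = e`. -/
theorem stmt_13 (n k s r : ℕ) (hn : 1 < n) (hs0 : 0 < s) (hsn : s < n)
    (C : Matrix (Fin n) (Fin n) ℝ) (hC : C.PosSemidef)
    (hr : C.rank = r) (hrs : s ≤ r)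
    (F : Matrix (Fin n) (Fin k) ℝ) (hF : C = F * Fᵀ) (hk1 : r ≤ k) (hk2 : k ≤ n)
    (x : Fin n → ℝ) (hx0 : ∀ i, 0 ≤ x i) (hx1 : ∀ i, x i ≤ 1)
    (hsum : (∑ i, x i) = (s : ℝ)) (hxr : s ≤ (FDD n k F x 1).rank)
    (hopt : ∀ y : Fin n → ℝ, (∀ i, 0 ≤ y i) → (∀ i, y i ≤ 1) → (∑ i, y i) = (s : ℝ) →
      s ≤ (FDD n k F y 1).rank → fDD n k s F y 1 ≤ fDD n k s F x 1)
    (Q : Matrix (Fin k) (Fin k) ℝ) (lam : ℕ → ℝ)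
    (hdec : IsSpectralDecomp n k F x 1 Q lam) :
    ∀ i, 0 < x i → (gMat n k s F Q lam) i i = 1 := by
  obtain ⟨hQ1, hQ2, hnn, hanti⟩ := hdec
  have hQ : Diagonalizes Q (fun j => lam (j + 1)) (FDD n k F x 1) := ⟨hQ1, hQ2⟩
  have hnn' : ∀ i, 1 ≤ i → i ≤ k → 0 ≤ lam i := fun i _ _ => hnn i
  obtain ⟨hsk, hpos⟩ := hQ.pos_of_le_rank hs0 hxr hnn' hanti
  have hθ := (isIota_iotaOf hs0 hsk hnn').isWaterLevel hsk hanti hpos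
  set θ := avgTail k s lam (iotaOf k s lam) with hθdef
  have hβ := betaOf_eq hs0 hsk hnn' hanti
  have hgrad := fun {i j : Fin n} => grad_le_grad_of_isMax (i := i) (j := j) hs0 hx0 hx1 hsum hxr
    hopt hQ (fun j => hnn _) hθ
  rw [← hθdef] at hβ
  rw [← hβ] at hgrad
  have hG : F * (Q * diagonal (betaOf k s lam) * Qᵀ) * Fᵀ = gMat n k s F Q lam := by
    simp only [gMat, Matrix.mul_assoc]
  have hβ0 : ∀ j, 0 ≤ betaOf k s lam j := fun j => by
    rw [hβ]
    exact inv_nonneg.mpr (hθ.pos.le.trans (le_max_right _ _))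
  have hβd : ∀ j : Fin k, betaOf k s lam j * lam (j + 1) = min θ (lam (j + 1)) / θ := fun j => by
    simp only [hβ]
    have hθ0 := hθ.pos
    rcases le_total θ (lam (j + 1)) with h | h
    · rw [max_eq_left h, min_eq_left h, div_self hθ0.ne', inv_mul_cancel₀ (hθ0.trans_le h).ne']
    · rw [max_eq_right h, min_eq_right h]; ring
  have hlev := mul_grad_le_one hx0 hQ hβ0 fun j => by
    rw [hβd j]; exact (div_le_one hθ.pos).mpr (min_le_left _ _)
  have htr : ∑ l, x l * gMat n k s F Q lam l l = s := by
    rw [← hG, ← trace_mul_FDD, hQ.trace_conj_mul_self, Finset.sum_congr rfl fun j _ => hβd j,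
      ← Finset.sum_div, hθ.sum_min, mul_div_cancel_right₀ _ hθ.pos.ne']
  rw [hG] at hgrad hlev
  have hle : ∀ i, 0 < x i → gMat n k s F Q lam i i ≤ 1 := fun i hi => by
    rcases (hx1 i).lt_or_eq with h1 | h1
    · have h2 : ∑ l, x l * gMat n k s F Q lam i i ≤ ∑ l, x l * gMat n k s F Q lam l l :=
        Finset.sum_le_sum fun l _ => by
          rcases (hx0 l).lt_or_eq with h | h
          · exact mul_le_mul_of_nonneg_left (hgrad h1 h) h.le
          · rw [← h, zero_mul, zero_mul]
      rw [← Finset.sum_mul, hsum, htr] at h2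
      have : (0 : ℝ) < s := by exact_mod_cast hs0
      nlinarith
    · have := hlev i
      rwa [h1, one_mul] at this
  have hterm : ∀ l ∈ Finset.univ, x l * gMat n k s F Q lam l l ≤ x l := fun l _ => by
    rcases (hx0 l).lt_or_eq with h | h
    · nlinarith [hle l h]
    · rw [← h, zero_mul]
  intro i hi
  have := (Finset.sum_eq_sum_iff_of_le hterm).mp (htr.trans hsum.symm) i (Finset.mem_univ i)
  exact (mul_eq_left₀ hi.ne').mp this

end
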